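/- arXiv:2511.09459 — 6 statements merged into one kernel-verified Lean document; each statement's English description precedes it below -/
import Mathlib

section
/- Let G be a group, m ≥ 1 an integer, and for each j ∈ {1,…,m} let ρ_j : G → G_j be a surjective group homomorphism onto a group G_j. Let N be a perfect subgroup of G_1 (i.e. N equals its own commutator subgroup). Assume that for every j with 2 ≤ j ≤ m and every x ∈ N there exists g ∈ G with ρ_1(g) = x and ρ_j(g) = 1. Then for every x ∈ N there exists g ∈ G with ρ_1(g) = x and ρ_j(g) = 1 for all j with 2 ≤ j ≤ m; equivalently, N is contained in the image under ρ_1 of the intersection of the kernels of ρ_2, …, ρ_m. -/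
/-- If a perfect subgroup is contained in the image of each of finitely many normal subgroups, then
it is contained in the image of their intersection. -/
theorem Subgroup.le_map_iInf_of_commutator_eq_self {ι G H : Type*} [Group G] [Group H]
    (f : G →* H) {N : Subgroup H} (hN : ⁅N, N⁆ = N) (hf : N ≤ f.range)
    (K : ι → Subgroup G) [∀ i, (K i).Normal] (s : Finset ι) (h : ∀ i ∈ s, N ≤ (K i).map f) :
    N ≤ (⨅ i ∈ s, K i).map f := by
  classical
  induction s using Finset.induction_on with
  | empty => simpa [← MonoidHom.range_eq_map] using hf
  | insert a s _ ih =>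
    have : (⨅ i ∈ s, K i).Normal :=
      Subgroup.normal_iInf_normal fun i => Subgroup.normal_iInf_normal fun _ => inferInstance
    rw [Finset.iInf_insert]
    calc N = ⁅N, N⁆ := hN.symm
      _ ≤ ⁅(K a).map f, (⨅ i ∈ s, K i).map f⁆ :=
        Subgroup.commutator_mono (h a (Finset.mem_insert_self a s))
          (ih fun i hi => h i (Finset.mem_insert_of_mem hi))
      _ = ⁅K a, ⨅ i ∈ s, K i⁆.map f := (Subgroup.map_commutator _ _ f).symm
      _ ≤ (K a ⊓ ⨅ i ∈ s, K i).map f := Subgroup.map_mono (Subgroup.commutator_le_inf _ _)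

/-- The lifting step (Serre, Ribet) used in the generalized Goursat–Kolchin–Ribet
criterion: if `N` is a perfect subgroup of `G₁` and every element of `N` can be
lifted to an element of `G` killed by each single `ρ j` (`j ≠ 1`), then every
element of `N` can be lifted to an element of `G` killed by all `ρ j` (`j ≠ 1`)
simultaneously. -/
theorem stmt_0 {m : ℕ} (hm : 1 ≤ m) (G : Type*) [Group G]
    (Gf : Fin m → Type*) [∀ j, Group (Gf j)]
    (ρ : ∀ j, G →* Gf j) (hsurj : ∀ j, Function.Surjective (ρ j))
    (N : Subgroup (Gf ⟨0, hm⟩)) (hN : ⁅N, N⁆ = N)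
    (h : ∀ j : Fin m, j ≠ ⟨0, hm⟩ → ∀ x ∈ N, ∃ g : G, ρ ⟨0, hm⟩ g = x ∧ ρ j g = 1) :
    ∀ x ∈ N, ∃ g : G, ρ ⟨0, hm⟩ g = x ∧ ∀ j : Fin m, j ≠ ⟨0, hm⟩ → ρ j g = 1 := by
  intro x hx
  obtain ⟨g, hg, rfl⟩ := Subgroup.le_map_iInf_of_commutator_eq_self (ρ ⟨0, hm⟩) hN
    (fun y _ => hsurj _ y) (fun j => (ρ j).ker) (Finset.univ.erase ⟨0, hm⟩)
    (fun j hj y hy => by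
      obtain ⟨g, hg, hg'⟩ := h j (Finset.ne_of_mem_erase hj) y hy
      exact ⟨g, hg', hg⟩) hx
  refine ⟨g, rfl, fun j hj => ?_⟩
  have hg' : g ∈ ⨅ j ∈ Finset.univ.erase ⟨0, hm⟩, (ρ j).ker := hg
  simp only [Subgroup.mem_iInf] at hg'
  exact hg' j (Finset.mem_erase.2 ⟨hj, Finset.mem_univ j⟩)
end

section
/- Let k be a field, G a group and m ≥ 1 an integer. For each i ∈ {1,…,m}, let π_i : G → G_i be a surjective group homomorphism onto a group G_i, let ρ_i : G_i → GL(V_i) be a k-linear representation of G_i on a k-vector space V_i, and let N_i be a perfect normal subgroup of G_i such that the space of N_i-coinvariants of V_i is zero. For i ≠ j, set H_{i,j} = { x ∈ G_i : there exists g ∈ G with π_i(g) = x and π_j(g) = 1 }. Then at least one of the following holds: (1) the space of G-coinvariants of the representation of G on the tensor product V_1 ⊗_k ⋯ ⊗_k V_m, in which g ∈ G acts as ρ_1(π_1(g)) ⊗ ⋯ ⊗ ρ_m(π_m(g)), is zero; or (2) for each i ∈ {1,…,m} there exists j ≠ i such that N_i is not contained in H_{i,j}. -/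
open scoped TensorProduct

open scoped commutatorElement in
/-- If a subgroup `N` of `A` with `⁅N, N⁆ = N` lies, for each `j` in a finite set `s`, in the image
under `f` of the kernel of `π j`, then it lies in the image of the intersection of these kernels. -/
theorem exists_forall_eq_one_of_commutator_eq_self {G A ι : Type*} [Group G] [Group A]
    {B : ι → Type*} [∀ j, Group (B j)] (f : G →* A) (hf : Function.Surjective f)
    (π : ∀ j, G →* B j) {N : Subgroup A} (hN : ⁅N, N⁆ = N) (s : Finset ι)
    (h : ∀ j ∈ s, ∀ x ∈ N, ∃ g, f g = x ∧ π j g = 1) :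
    ∀ x ∈ N, ∃ g, f g = x ∧ ∀ j ∈ s, π j g = 1 := by
  classical
  induction s using Finset.induction_on with
  | empty => exact fun x _ => (hf x).imp fun g hg => ⟨hg, by simp⟩
  | insert j s _ ih =>
    have hs := ih fun l hl => h l (Finset.mem_insert_of_mem hl)
    have hj := h j (Finset.mem_insert_self j s)
    have hle : N ≤ (⨅ l ∈ insert j s, (π l).ker).map f := by
      conv_lhs => rw [← hN]
      refine Subgroup.commutator_le.2 fun x hx y hy => ?_
      obtain ⟨a, rfl, ha⟩ := hs x hx
      obtain ⟨b, rfl, hb⟩ := hj y hy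
      refine ⟨⁅a, b⁆, ?_, map_commutatorElement f a b⟩
      simp only [SetLike.mem_coe, Subgroup.mem_iInf, MonoidHom.mem_ker, map_commutatorElement]
      intro l hl
      rcases Finset.mem_insert.1 hl with rfl | hl
      · rw [hb, commutatorElement_one_right]
      · rw [ha l hl, commutatorElement_one_left]
    intro x hx
    obtain ⟨g, hg, rfl⟩ := hle hx
    exact ⟨g, rfl, by simpa only [SetLike.mem_coe, Subgroup.mem_iInf, MonoidHom.mem_ker] using hg⟩

/-- A submodule of a tensor product is everything if, for a fixed index `i`, it contains all pure
tensors whose `i`-th entry lies in a given spanning set. -/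
theorem PiTensorProduct.eq_top_of_tprod_update_mem {k ι : Type*} [CommSemiring k] [DecidableEq ι]
    {V : ι → Type*} [∀ i, AddCommMonoid (V i)] [∀ i, Module k (V i)]
    (W : Submodule k (⨂[k] i, V i)) (i : ι) {S : Set (V i)} (hS : Submodule.span k S = ⊤)
    (h : ∀ (v : ∀ i, V i), ∀ x ∈ S, PiTensorProduct.tprod k (Function.update v i x) ∈ W) :
    W = ⊤ := by
  rw [eq_top_iff, ← PiTensorProduct.span_tprod_eq_top, Submodule.span_le]
  rintro _ ⟨v, rfl⟩
  have hle : Submodule.span k S ≤ W.comap ((PiTensorProduct.tprod k).toLinearMap v i) :=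
    Submodule.span_le.2 fun x hx => h v x hx
  have hv : v i ∈ Submodule.span k S := hS ▸ Submodule.mem_top
  simpa using hle hv

/-- Generalized Goursat–Kolchin–Ribet criterion: either the `G`-coinvariants of the
tensor product representation vanish, or for each `i` there is `j ≠ i` such that
the perfect normal subgroup `N i` is not contained in the Goursat kernel `H_{i,j}`. -/
theorem stmt_1 (k : Type*) [Field k] {m : ℕ} (hm : 1 ≤ m)
    (G : Type*) [Group G]
    (Gf : Fin m → Type*) [∀ i, Group (Gf i)]
    (π : ∀ i, G →* Gf i) (hπ : ∀ i, Function.Surjective (π i))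
    (V : Fin m → Type*) [∀ i, AddCommGroup (V i)] [∀ i, Module k (V i)]
    (ρ : ∀ i, Representation k (Gf i) (V i))
    (N : ∀ i, Subgroup (Gf i)) (hNnormal : ∀ i, (N i).Normal)
    (hNperf : ∀ i, ⁅N i, N i⁆ = N i)
    (hNco : ∀ i, Submodule.span k
      {x : V i | ∃ g ∈ N i, ∃ v : V i, ρ i g v - v = x} = ⊤) :
    (Submodule.span k {x : ⨂[k] i, V i | ∃ (g : G) (y : ⨂[k] i, V i),
        PiTensorProduct.map (fun i => ρ i (π i g)) y - y = x} = ⊤)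
    ∨ (∀ i, ∃ j, j ≠ i ∧
        ¬ ((N i : Set (Gf i)) ⊆ {x : Gf i | ∃ g : G, π i g = x ∧ π j g = 1})) := by
  by_contra! hcon
  obtain ⟨hne, i, hi⟩ := hcon
  refine hne (PiTensorProduct.eq_top_of_tprod_update_mem _ i (hNco i) ?_)
  rintro v _ ⟨n, hn, w, rfl⟩
  obtain ⟨g, rfl, hg⟩ := exists_forall_eq_one_of_commutator_eq_self (π i) (hπ i) π (hNperf i)
    (Finset.univ.erase i) (fun j hj x hx => hi j (Finset.ne_of_mem_erase hj) hx) n hn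
  refine Submodule.subset_span
    ⟨g, PiTensorProduct.tprod k (Function.update v i w), ?_⟩
  rw [PiTensorProduct.map_tprod, MultilinearMap.map_update_sub]
  congr 2
  funext j
  by_cases hj : j = i
  · subst hj
    simp
  · simp [hj, hg j (by simp [hj])]
end

section
/- Let G be a finite group, and let M and N be normal subgroups of G. Suppose N is quasisimple and N is not contained in M. Then M commutes with N, i.e. mn = nm for every m ∈ M and n ∈ N. -/
open scoped commutatorElement

namespace Subgroup

variable {G : Type*} [Group G]

/-- In a perfect group, a normal subgroup that covers the central quotient is the whole group. -/
theorem eq_top_of_map_mk'_center_eq_top (hperf : _root_.commutator G = ⊤) (K : Subgroup G) [K.Normal]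
    (h : K.map (QuotientGroup.mk' (center G)) = ⊤) : K = ⊤ := by
  rw [eq_top_iff, ← hperf, _root_.commutator_def, commutator_le]
  intro a _ b _
  obtain ⟨k, hk, hka⟩ : QuotientGroup.mk' (center G) a ∈ K.map (QuotientGroup.mk' (center G)) :=
    h ▸ mem_top _
  obtain ⟨z, hz, rfl⟩ := (QuotientGroup.mk'_eq_mk' (center G)).mp hka
  have hzb : ⁅k * z, b⁆ = ⁅k, b⁆ := by
    have hcomm : b * z = z * b := mem_center_iff.mp hz b
    have hconj : z * b * z⁻¹ = b := by rw [← hcomm, mul_inv_cancel_right]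
    calc ⁅k * z, b⁆ = k * (z * b * z⁻¹) * k⁻¹ * b⁻¹ := by rw [commutatorElement_def]; group
      _ = ⁅k, b⁆ := by rw [hconj, commutatorElement_def]
  rw [hzb]
  exact commutator_le_left K ⊤ (commutator_mem_commutator hk (mem_top b))

/-- A normal subgroup of a group which is perfect with simple central quotient is either
central or the whole group. -/
theorem le_center_or_eq_top (hperf : _root_.commutator G = ⊤) [IsSimpleGroup (G ⧸ center G)]
    (K : Subgroup G) [K.Normal] : K ≤ center G ∨ K = ⊤ := by
  have hmap : (K.map (QuotientGroup.mk' (center G))).Normal :=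
    Normal.map inferInstance _ (QuotientGroup.mk'_surjective _)
  refine hmap.eq_bot_or_eq_top.imp (fun h => ?_) (eq_top_of_map_mk'_center_eq_top hperf K)
  simpa using (map_eq_bot_iff K).mp h

end Subgroup

/-- If `M` and `N` are normal subgroups of a finite group `G`, with `N` quasisimple
(perfect with simple central quotient) and `N` not contained in `M`, then `M`
commutes with `N` elementwise. -/
theorem stmt_2 (G : Type*) [Group G] [Finite G]
    (M N : Subgroup G) (hM : M.Normal) (hN : N.Normal)
    (hperf : commutator ↥N = ⊤)
    (hqs : IsSimpleGroup (↥N ⧸ Subgroup.center ↥N))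
    (hNM : ¬ N ≤ M) :
    ∀ x ∈ M, ∀ y ∈ N, x * y = y * x := by
  have hcenter : M.subgroupOf N ≤ Subgroup.center N :=
    (Subgroup.le_center_or_eq_top hperf (M.subgroupOf N)).resolve_right
      fun h => hNM (Subgroup.subgroupOf_eq_top.mp h)
  have hMNN : ⁅⁅M, N⁆, N⁆ = ⊥ := by
    rw [eq_bot_iff]
    refine (Subgroup.commutator_mono (Subgroup.commutator_le_inf M N) le_rfl).trans ?_
    rw [Subgroup.commutator_le]
    rintro a ⟨haM, haN⟩ b hb
    have hba : b * a = a * b := congrArg Subtype.val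
      (Subgroup.mem_center_iff.mp (hcenter (show (⟨a, haN⟩ : N) ∈ M.subgroupOf N from haM)) ⟨b, hb⟩)
    exact Subgroup.mem_bot.mpr (commutatorElement_eq_one_iff_mul_comm.mpr hba.symm)
  have hNNM : ⁅⁅N, N⁆, M⁆ = ⊥ :=
    Subgroup.commutator_commutator_eq_bot_of_rotate
      (by rwa [Subgroup.commutator_comm N M]) hMNN
  have hNN : ⁅N, N⁆ = N := by
    rw [← Subgroup.map_subtype_commutator, hperf, ← MonoidHom.range_eq_map, Subgroup.range_subtype]
  rw [hNN, Subgroup.commutator_comm, eq_bot_iff, Subgroup.commutator_le] at hNNM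
  exact fun x hx y hy => commutatorElement_eq_one_iff_mul_comm.mp
    (Subgroup.mem_bot.mp (hNNM x hx y hy))
end

section
/- Let E be an algebraically closed field of characteristic 0, let V be a nonzero finite-dimensional E-vector space, and let G be a finite subgroup of GL(V) such that V is an irreducible G-module (the only G-invariant subspaces of V are 0 and V). Let N be a quasisimple normal subgroup of G such that V is already irreducible as an N-module. Then N is a characteristic subgroup of G: for every group automorphism φ of G one has φ(N) = N. -/
open scoped commutatorElement

/-- A proper normal subgroup of a quasisimple group is central. -/
theorem le_center_or_eq_top_of_quasisimple {Q : Type*} [Group Q]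
    (hperf : commutator Q = ⊤) (hsimple : IsSimpleGroup (Q ⧸ Subgroup.center Q))
    (K : Subgroup Q) [hK : K.Normal] : K ≤ Subgroup.center Q ∨ K = ⊤ := by
  have hmap : (K.map (QuotientGroup.mk' (Subgroup.center Q))).Normal :=
    hK.map _ (QuotientGroup.mk'_surjective _)
  rcases hmap.eq_bot_or_eq_top with h | h
  · left
    rwa [Subgroup.map_eq_bot_iff, QuotientGroup.ker_mk'] at h
  · right
    have hfactor : ∀ x : Q, ∃ k ∈ K, ∃ z ∈ Subgroup.center Q, x = k * z := by
      intro x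
      have hx : QuotientGroup.mk' (Subgroup.center Q) x ∈
          K.map (QuotientGroup.mk' (Subgroup.center Q)) := h ▸ Subgroup.mem_top _
      obtain ⟨k, hk, hkx⟩ := hx
      exact ⟨k, hk, k⁻¹ * x, QuotientGroup.eq.mp hkx, by group⟩
    rw [eq_top_iff, ← hperf, commutator_def, Subgroup.commutator_le]
    intro x _ y _
    obtain ⟨k, hk, z, hz, rfl⟩ := hfactor x
    obtain ⟨l, hl, w, hw, rfl⟩ := hfactor y
    rw [Subgroup.mem_center_iff] at hz hw
    have hcomm : ⁅k * z, l * w⁆ = ⁅k, l⁆ := by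
      simp only [commutatorElement_def, mul_inv_rev]
      calc k * z * (l * w) * (z⁻¹ * k⁻¹) * (w⁻¹ * l⁻¹)
          = k * (z * (l * w)) * z⁻¹ * k⁻¹ * w⁻¹ * l⁻¹ := by group
        _ = k * l * (w * k⁻¹) * w⁻¹ * l⁻¹ := by rw [← hz (l * w)]; group
        _ = k * l * k⁻¹ * l⁻¹ := by rw [← hw k⁻¹]; group
    rw [hcomm, commutatorElement_def]
    exact K.mul_mem (K.mul_mem (K.mul_mem hk hl) (K.inv_mem hk)) (K.inv_mem hl)

/-- A quasisimple subgroup `N` that normalizes and is normalized by a subgroup `M` either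
lies in `M` or commutes with `M`. -/
theorem le_or_commutator_eq_bot_of_quasisimple {G : Type*} [Group G]
    (N M : Subgroup G) (hperf : commutator ↥N = ⊤)
    (hsimple : IsSimpleGroup (↥N ⧸ Subgroup.center ↥N))
    (hMN : ∀ y ∈ M, ∀ x ∈ N, y * x * y⁻¹ ∈ N) (hNM : ∀ x ∈ N, ∀ y ∈ M, x * y * x⁻¹ ∈ M) :
    N ≤ M ∨ ⁅N, M⁆ = ⊥ := by
  have hnormal : (M.subgroupOf N).Normal :=
    ⟨fun y hy x => hNM x x.2 y hy⟩
  rcases le_center_or_eq_top_of_quasisimple hperf hsimple (M.subgroupOf N) with h | h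
  · right
    have hself : ⁅N, N⁆ = N := by
      rw [← Subgroup.map_subtype_commutator, hperf, ← MonoidHom.range_eq_map,
        Subgroup.range_subtype]
    have hcentral : ⁅⁅N, M⁆, N⁆ = ⊥ := by
      rw [Subgroup.commutator_eq_bot_iff_le_centralizer, Subgroup.commutator_le]
      intro x hx y hy
      have hN : ⁅x, y⁆ ∈ N := by
        rw [commutatorElement_def, mul_assoc, mul_assoc, ← mul_assoc y]
        exact N.mul_mem hx (hMN y hy _ (N.inv_mem hx))
      have hM : ⁅x, y⁆ ∈ M := M.mul_mem (hNM x hx y hy) (M.inv_mem hy)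
      have hz : (⟨⁅x, y⁆, hN⟩ : N) ∈ Subgroup.center N := h hM
      rw [Subgroup.mem_center_iff] at hz
      rw [Subgroup.mem_centralizer_iff]
      exact fun n hn => congrArg Subtype.val (hz ⟨n, hn⟩)
    have := Subgroup.commutator_commutator_eq_bot_of_rotate hcentral
      (by rwa [Subgroup.commutator_comm M N])
    rwa [hself] at this
  · left
    exact Subgroup.subgroupOf_eq_top.mp h

/-- **Schur's lemma**: an endomorphism commuting with an irreducible set of endomorphisms of a
finite-dimensional space over an algebraically closed field is a scalar. -/
theorem Module.End.exists_eq_smul_of_commute_of_irreducible {E V : Type*} [Field E]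
    [IsAlgClosed E] [AddCommGroup V] [Module E V] [FiniteDimensional E V] [Nontrivial V]
    (S : Set (Module.End E V))
    (hS : ∀ W : Submodule E V, (∀ x ∈ S, ∀ v ∈ W, x v ∈ W) → W = ⊥ ∨ W = ⊤)
    (f : Module.End E V) (hf : ∀ x ∈ S, Commute f x) : ∃ c : E, ∀ v, f v = c • v := by
  obtain ⟨c, hc⟩ := Module.End.exists_eigenvalue f
  refine ⟨c, fun v => ?_⟩
  have htop : f.eigenspace c = ⊤ := by
    refine (hS _ fun x hx v hv => ?_).resolve_left hc
    rw [Module.End.mem_eigenspace_iff] at hv ⊢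
    rw [← Module.End.mul_apply, (hf x hx).eq, Module.End.mul_apply, hv, map_smul]
  exact Module.End.mem_eigenspace_iff.mp (htop ▸ Submodule.mem_top)

/-- A quasisimple group is not commutative. -/
theorem not_forall_mul_comm_of_quasisimple {Q : Type*} [Group Q]
    (hsimple : IsSimpleGroup (Q ⧸ Subgroup.center Q)) : ¬ ∀ x y : Q, x * y = y * x := by
  intro h
  obtain ⟨q, hq⟩ := exists_ne (1 : Q ⧸ Subgroup.center Q)
  obtain ⟨x, rfl⟩ := QuotientGroup.mk_surjective q
  exact hq ((QuotientGroup.eq_one_iff x).mpr (Subgroup.mem_center_iff.mpr fun y => h y x))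


/-- If `G` is a finite irreducible subgroup of `GL(V)` over an algebraically closed
field of characteristic `0`, and `N` is a quasisimple normal subgroup of `G` acting
irreducibly on `V`, then `N` is a characteristic subgroup of `G`. -/
theorem stmt_3 (E : Type*) [Field E] [IsAlgClosed E] [CharZero E]
    (V : Type*) [AddCommGroup V] [Module E V] [FiniteDimensional E V] [Nontrivial V]
    (G : Subgroup (V →ₗ[E] V)ˣ) [Finite G]
    (hGirr : ∀ W : Submodule E V,
      (∀ g ∈ G, ∀ v ∈ W, (g : V →ₗ[E] V) v ∈ W) → W = ⊥ ∨ W = ⊤)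
    (N : Subgroup (V →ₗ[E] V)ˣ) (hNG : N ≤ G)
    (hNnorm : ∀ g ∈ G, ∀ x ∈ N, g * x * g⁻¹ ∈ N)
    (hNperf : commutator ↥N = ⊤)
    (hNqs : IsSimpleGroup (↥N ⧸ Subgroup.center ↥N))
    (hNirr : ∀ W : Submodule E V,
      (∀ x ∈ N, ∀ v ∈ W, (x : V →ₗ[E] V) v ∈ W) → W = ⊥ ∨ W = ⊤)
    (φ : ↥G ≃* ↥G) :
    Subgroup.map φ.toMonoidHom (N.subgroupOf G) = N.subgroupOf G := by
  set N' := N.subgroupOf G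
  have hN'normal : N'.Normal := ⟨fun x hx g => hNnorm g g.2 x hx⟩
  have hM'normal : (N'.map φ.toMonoidHom).Normal := hN'normal.map _ φ.surjective
  set M := (N'.map φ.toMonoidHom).map G.subtype
  have hMG : M ≤ G := Subgroup.map_subtype_le _
  have hNM : ∀ x ∈ N, ∀ y ∈ M, x * y * x⁻¹ ∈ M := by
    rintro x hx _ ⟨y, hy, rfl⟩
    exact ⟨_, hM'normal.conj_mem y hy ⟨x, hNG hx⟩, rfl⟩
  have hMN : ∀ y ∈ M, ∀ x ∈ N, y * x * y⁻¹ ∈ N := fun y hy => hNnorm y (hMG hy)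
  rcases le_or_commutator_eq_bot_of_quasisimple N M hNperf hNqs hMN hNM with h | h
  · have hle : N' ≤ N'.map φ.toMonoidHom := by
      intro x hx
      obtain ⟨y, hy, hyx⟩ := h (show (x : (V →ₗ[E] V)ˣ) ∈ N from hx)
      exact Subtype.ext hyx ▸ hy
    exact (Subgroup.eq_of_le_of_card_ge hle
      (Subgroup.card_map_of_injective φ.injective).le).symm
  · exfalso
    have hscalar : ∀ y ∈ M, ∃ c : E, ∀ v, (y : V →ₗ[E] V) v = c • v := by
      intro y hy
      refine Module.End.exists_eq_smul_of_commute_of_irreducible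
        ((fun x : (V →ₗ[E] V)ˣ => (x : V →ₗ[E] V)) '' N) (fun W hW => hNirr W fun x hx =>
          hW x ⟨x, hx, rfl⟩) y ?_
      rintro _ ⟨x, hx, rfl⟩
      have hxy := Subgroup.mem_centralizer_iff.mp
        (Subgroup.commutator_eq_bot_iff_le_centralizer.mp h hx) y hy
      exact congrArg Units.val hxy
    have hcomm : ∀ a ∈ M, ∀ b ∈ M, a * b = b * a := by
      intro a ha b hb
      obtain ⟨c, hc⟩ := hscalar a ha
      obtain ⟨d, hd⟩ := hscalar b hb
      refine Units.ext (LinearMap.ext fun v => ?_)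
      simp only [Units.val_mul, Module.End.mul_apply, hc, hd, smul_comm c d v]
    refine not_forall_mul_comm_of_quasisimple hNqs fun x y => Subtype.ext ?_
    have hmem : ∀ x : N, ((φ ⟨x, hNG x.2⟩ : G) : (V →ₗ[E] V)ˣ) ∈ M := fun x =>
      ⟨_, ⟨⟨x, hNG x.2⟩, x.2, rfl⟩, rfl⟩
    have hφ : φ (⟨x, hNG x.2⟩ * ⟨y, hNG y.2⟩) = φ (⟨y, hNG y.2⟩ * ⟨x, hNG x.2⟩) := by
      rw [map_mul, map_mul]
      exact Subtype.ext (hcomm _ (hmem x) _ (hmem y))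
    exact congrArg G.subtype (φ.injective hφ)
end

section
/- Let k be an algebraically closed field of characteristic different from 2 and let n ≥ 3 be an integer. Let H be a normal subgroup of the orthogonal group O_n(k). If H does not contain SO_n(k), then H is contained in the center {I_n, −I_n} of O_n(k); in particular every element of H is I_n or −I_n. -/
attribute [local instance] starRingOfComm

open Matrix

namespace Matrix.orthogonalGroup

variable {k ι : Type*} [Field k] [Fintype ι]

theorem exists_unit_smul_eq [IsAlgClosed k] {v : ι → k} (hv : v ⬝ᵥ v ≠ 0) :
    ∃ (c : k) (u : ι → k), c ≠ 0 ∧ u ⬝ᵥ u = 1 ∧ v = c • u := by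
  obtain ⟨c, hc⟩ := IsAlgClosed.exists_pow_nat_eq (v ⬝ᵥ v) two_pos
  have hc0 : c ≠ 0 := by
    rintro rfl
    simp [eq_comm, hv] at hc
  refine ⟨c, c⁻¹ • v, hc0, ?_, (smul_inv_smul₀ hc0 v).symm⟩
  simp only [smul_dotProduct, dotProduct_smul, smul_eq_mul, ← hc]
  field_simp

/-- The normalized component of `u` orthogonal to a unit vector `v`. -/
theorem exists_unit_orthogonal_component [IsAlgClosed k] {u v : ι → k} (hu : u ⬝ᵥ u = 1)
    (hv : v ⬝ᵥ v = 1) (h : (v ⬝ᵥ u) ^ 2 ≠ 1) : ∃ (d : k) (w : ι → k), d ≠ 0 ∧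
      d ^ 2 = 1 - (v ⬝ᵥ u) ^ 2 ∧ w ⬝ᵥ w = 1 ∧ v ⬝ᵥ w = 0 ∧ u = (v ⬝ᵥ u) • v + d • w := by
  obtain ⟨d, hd⟩ := IsAlgClosed.exists_pow_nat_eq (1 - (v ⬝ᵥ u) ^ 2) two_pos
  have hd0 : d ≠ 0 := by
    rintro rfl
    exact h (by linear_combination hd)
  refine ⟨d, d⁻¹ • (u - (v ⬝ᵥ u) • v), hd0, hd, ?_, ?_, ?_⟩
  · simp only [smul_dotProduct, dotProduct_smul, sub_dotProduct, dotProduct_sub, smul_eq_mul, hu,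
      hv, dotProduct_comm u v]
    field_simp
    linear_combination -hd
  · simp [hv]
  · rw [smul_inv_smul₀ hd0, add_sub_cancel]

variable [DecidableEq ι]

theorem mulVec_dotProduct_mulVec (g : orthogonalGroup ι k) (v w : ι → k) :
    (g.1 *ᵥ v) ⬝ᵥ (g.1 *ᵥ w) = v ⬝ᵥ w := by
  rw [dotProduct_mulVec, ← mulVec_transpose, mulVec_mulVec,
    (mem_orthogonalGroup_iff' ι k).1 g.2, one_mulVec]

theorem inv_mulVec_mulVec (g : orthogonalGroup ι k) (v : ι → k) :
    (g⁻¹).1 *ᵥ (g.1 *ᵥ v) = v := by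
  have h : (g⁻¹).1 * g.1 = 1 := congrArg Subtype.val (inv_mul_cancel g)
  rw [mulVec_mulVec, h, one_mulVec]

theorem mulVec_inv_mulVec (g : orthogonalGroup ι k) (v : ι → k) :
    g.1 *ᵥ ((g⁻¹).1 *ᵥ v) = v :=
  inv_mulVec_mulVec g⁻¹ v

theorem mul_mulVec (g h : orthogonalGroup ι k) (v : ι → k) :
    (g * h).1 *ᵥ v = g.1 *ᵥ (h.1 *ᵥ v) :=
  (mulVec_mulVec v g.1 h.1).symm

theorem ext_mulVec {g h : orthogonalGroup ι k} (H : ∀ v, g.1 *ᵥ v = h.1 *ᵥ v) : g = h :=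
  Subtype.ext (mulVec_injective (funext H))

/-- The reflection in the hyperplane orthogonal to `v`; it is the identity if `v` is isotropic. -/
def reflection (v : ι → k) : orthogonalGroup ι k :=
  ⟨1 - (2 / (v ⬝ᵥ v)) • vecMulVec v v, by
    rw [mem_orthogonalGroup_iff]
    simp only [transpose_sub, transpose_one, transpose_smul, transpose_vecMulVec, sub_mul, mul_sub,
      one_mul, mul_one, smul_mul_smul_comm, vecMulVec_mul_vecMulVec, vecMulVec_smul, smul_smul]
    by_cases h : v ⬝ᵥ v = 0
    · simp [h]
    · rw [sub_sub, sub_eq_self, add_sub_assoc', sub_eq_zero, ← add_smul]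
      congr 1
      field_simp
      ring⟩

theorem reflection_mulVec (v x : ι → k) :
    (reflection v).1 *ᵥ x = x - (2 * (v ⬝ᵥ x) / (v ⬝ᵥ v)) • v := by
  simp only [reflection, sub_mulVec, one_mulVec, smul_mulVec, vecMulVec_mulVec, op_smul_eq_smul,
    smul_smul]
  congr 2
  ring

theorem reflection_mulVec_of_dotProduct_eq_zero {v x : ι → k} (h : v ⬝ᵥ x = 0) :
    (reflection v).1 *ᵥ x = x := by
  simp [reflection_mulVec, h]

theorem det_reflection {v : ι → k} (h : v ⬝ᵥ v ≠ 0) : (reflection v).1.det = -1 := by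
  have : (reflection v).1 = 1 - vecMulVec ((2 / (v ⬝ᵥ v)) • v) v := by
    simp [reflection, smul_vecMulVec]
  rw [this, vecMulVec_eq Unit, det_one_sub_mul_comm]
  simp
  field_simp
  ring

theorem reflection_mul_self (v : ι → k) : reflection v * reflection v = 1 := by
  refine ext_mulVec fun x => ?_
  rw [mul_mulVec, reflection_mulVec, reflection_mulVec]
  by_cases h : v ⬝ᵥ v = 0
  · simp [h]
  · simp only [OneMemClass.coe_one, one_mulVec, dotProduct_sub, dotProduct_smul, smul_eq_mul,
      sub_sub, sub_eq_self, ← add_smul]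
    convert zero_smul k v
    field_simp
    ring

theorem reflection_smul {c : k} (hc : c ≠ 0) (v : ι → k) : reflection (c • v) = reflection v := by
  refine ext_mulVec fun x => ?_
  simp only [reflection_mulVec, smul_dotProduct, dotProduct_smul, smul_eq_mul, smul_smul]
  by_cases h : v ⬝ᵥ v = 0
  · simp [h]
  · congr 2
    field_simp

theorem reflection_neg (v : ι → k) : reflection (-v) = reflection v := by
  simpa using reflection_smul (neg_ne_zero.2 one_ne_zero) v

theorem reflection_mulVec_eq_conj (g : orthogonalGroup ι k) (v : ι → k) :
    reflection (g.1 *ᵥ v) = g * reflection v * g⁻¹ := by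
  refine ext_mulVec fun x => ?_
  obtain ⟨y, rfl⟩ : ∃ y, x = g.1 *ᵥ y := ⟨_, (mulVec_inv_mulVec g x).symm⟩
  rw [mul_mulVec, mul_mulVec, inv_mulVec_mulVec, reflection_mulVec, reflection_mulVec,
    mulVec_dotProduct_mulVec, mulVec_dotProduct_mulVec, mulVec_sub, mulVec_smul]

variable (k ι) in
/-- The subgroup generated by the reflections in nonisotropic vectors. -/
def reflectionSubgroup : Subgroup (orthogonalGroup ι k) :=
  Subgroup.closure (reflection '' {v | v ⬝ᵥ v ≠ 0})

theorem reflection_mem {v : ι → k} (hv : v ⬝ᵥ v ≠ 0) :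
    reflection v ∈ reflectionSubgroup k ι :=
  Subgroup.subset_closure ⟨v, hv, rfl⟩

theorem reflection_sub_mulVec {a b : ι → k} (h : a ⬝ᵥ a = b ⬝ᵥ b)
    (hab : (a - b) ⬝ᵥ (a - b) ≠ 0) : (reflection (a - b)).1 *ᵥ a = b := by
  have h1 : (a - b) ⬝ᵥ (a - b) = 2 * ((a - b) ⬝ᵥ a) := by
    simp only [sub_dotProduct, dotProduct_sub, dotProduct_comm b a, h]
    ring
  rw [reflection_mulVec, ← h1, div_self hab, one_smul, sub_sub_cancel]

/-- Vectors of the same nonzero length are exchanged by a product of reflections which fixes every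
vector orthogonal to both. -/
theorem exists_mulVec_eq (h2 : (2 : k) ≠ 0) {a b : ι → k} (h : a ⬝ᵥ a = b ⬝ᵥ b)
    (hb : b ⬝ᵥ b ≠ 0) : ∃ g ∈ reflectionSubgroup k ι, g.1 *ᵥ a = b ∧
      ∀ x, a ⬝ᵥ x = 0 → b ⬝ᵥ x = 0 → g.1 *ᵥ x = x := by
  by_cases hab : (a - b) ⬝ᵥ (a - b) = 0
  · have hab' : (a - -b) ⬝ᵥ (a - -b) ≠ 0 := by
      intro h0
      have : (2 * 2) * (b ⬝ᵥ b) = 0 := by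
        simp only [sub_dotProduct, dotProduct_sub, dotProduct_comm b a, h, neg_dotProduct,
          dotProduct_neg] at h0 hab
        linear_combination h0 + hab
      simp [h2, hb] at this
    refine ⟨reflection b * reflection (a - -b), mul_mem (reflection_mem hb) (reflection_mem hab'),
      ?_, fun x hax hbx => ?_⟩
    · rw [mul_mulVec, reflection_sub_mulVec (by simpa using h) hab', reflection_mulVec]
      simp only [dotProduct_neg, mul_neg, neg_div, mul_div_cancel_right₀ _ hb]
      module
    · rw [mul_mulVec, reflection_mulVec_of_dotProduct_eq_zero (v := a - -b),
        reflection_mulVec_of_dotProduct_eq_zero hbx]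
      simp [hax, hbx]
  · exact ⟨reflection (a - b), reflection_mem hab, reflection_sub_mulVec h hab, fun x hax hbx =>
      reflection_mulVec_of_dotProduct_eq_zero (by simp [sub_dotProduct, hax, hbx])⟩

/-- A weak form of the Cartan–Dieudonné theorem: the orthogonal group is generated by
reflections. -/
theorem mem_reflectionSubgroup (h2 : (2 : k) ≠ 0) (A : orthogonalGroup ι k) :
    A ∈ reflectionSubgroup k ι := by
  have key : ∀ s : Finset ι, ∃ g ∈ reflectionSubgroup k ι,
      ∀ i ∈ s, (g * A).1 *ᵥ Pi.single i 1 = Pi.single i 1 := by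
    intro s
    induction s using Finset.induction_on with
    | empty => exact ⟨1, one_mem _, by simp⟩
    | insert i s hi ih =>
      obtain ⟨g, hg, hgs⟩ := ih
      obtain ⟨h, hh, hhi, hfix⟩ := exists_mulVec_eq h2
        (a := (g * A).1 *ᵥ Pi.single i 1) (b := Pi.single i 1)
        (by rw [mulVec_dotProduct_mulVec]) (by simp)
      refine ⟨h * g, mul_mem hh hg, fun j hj => ?_⟩
      rw [mul_assoc, mul_mulVec]
      obtain rfl | hj := Finset.mem_insert.1 hj
      · exact hhi
      · have hij : (Pi.single i 1 : ι → k) ⬝ᵥ Pi.single j 1 = 0 := by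
          have : i ≠ j := by rintro rfl; exact hi hj
          simp [this]
        rw [hgs j hj, hfix _ _ hij]
        rw [← hgs j hj, mulVec_dotProduct_mulVec, hij]
  obtain ⟨g, hg, hgA⟩ := key Finset.univ
  have : g * A = 1 := Subtype.ext <| Matrix.ext_of_mulVec_single fun i => by
    rw [hgA i (Finset.mem_univ i), OneMemClass.coe_one, one_mulVec]
  rw [eq_inv_of_mul_eq_one_right this]
  exact inv_mem hg

theorem exists_mulVec_eq_and_mulVec_eq (h2 : (2 : k) ≠ 0) {v w v' w' : ι → k}
    (hv : v ⬝ᵥ v = 1) (hw : w ⬝ᵥ w = 1) (hvw : v ⬝ᵥ w = 0)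
    (hv' : v' ⬝ᵥ v' = 1) (hw' : w' ⬝ᵥ w' = 1) (hvw' : v' ⬝ᵥ w' = 0) :
    ∃ g : orthogonalGroup ι k, g.1 *ᵥ v = v' ∧ g.1 *ᵥ w = w' := by
  obtain ⟨g, -, hg, -⟩ := exists_mulVec_eq h2 (hv.trans hv'.symm) (by simp [hv'])
  obtain ⟨h, -, hh, hfix⟩ := exists_mulVec_eq h2 (a := g.1 *ᵥ w) (b := w')
    (by rw [mulVec_dotProduct_mulVec, hw, hw']) (by simp [hw'])
  refine ⟨h * g, ?_, by rw [mul_mulVec, hh]⟩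
  rw [mul_mulVec, hg, hfix]
  · rw [← hg, mulVec_dotProduct_mulVec, dotProduct_comm, hvw]
  · rw [dotProduct_comm, hvw']

theorem exists_unit_orthogonal (h2 : (2 : k) ≠ 0) {i j : ι} (hij : i ≠ j) {v : ι → k}
    (hv : v ⬝ᵥ v = 1) : ∃ p : ι → k, p ⬝ᵥ p = 1 ∧ v ⬝ᵥ p = 0 := by
  obtain ⟨g, -, hg, -⟩ := exists_mulVec_eq h2 (a := Pi.single i 1) (b := v) (by simp [hv])
    (by simp [hv])
  refine ⟨g.1 *ᵥ Pi.single j 1, ?_, ?_⟩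
  · rw [mulVec_dotProduct_mulVec]
    simp
  · rw [← hg, mulVec_dotProduct_mulVec]
    simp [hij]

theorem exists_unit_orthogonal_pair (h2 : (2 : k) ≠ 0) {i j l : ι} (hij : i ≠ j) (hil : i ≠ l)
    (hjl : j ≠ l) {v w : ι → k} (hv : v ⬝ᵥ v = 1) (hw : w ⬝ᵥ w = 1) (hvw : v ⬝ᵥ w = 0) :
    ∃ p : ι → k, p ⬝ᵥ p = 1 ∧ v ⬝ᵥ p = 0 ∧ w ⬝ᵥ p = 0 := by
  obtain ⟨g, hg, hg'⟩ := exists_mulVec_eq_and_mulVec_eq h2 (v := Pi.single i 1)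
    (w := Pi.single j 1) (by simp) (by simp) (by simp [hij]) hv hw hvw
  refine ⟨g.1 *ᵥ Pi.single l 1, ?_, ?_, ?_⟩
  · rw [mulVec_dotProduct_mulVec]
    simp
  · rw [← hg, mulVec_dotProduct_mulVec]
    simp [hil]
  · rw [← hg', mulVec_dotProduct_mulVec]
    simp [hjl]

/-- The reflections fixing `v` move a unit vector `u ≠ ±v` to unit vectors having any prescribed
inner product `e ≠ 1` with `u`. -/
theorem exists_dotProduct_reflection_mulVec_eq [IsAlgClosed k] (h2 : (2 : k) ≠ 0) {i j l : ι}
    (hij : i ≠ j) (hil : i ≠ l) (hjl : j ≠ l) {u v : ι → k} (hu : u ⬝ᵥ u = 1) (hv : v ⬝ᵥ v = 1)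
    (huv : u ≠ v) (huv' : u ≠ -v) {e : k} (he : e ≠ 1) :
    ∃ y : ι → k, y ⬝ᵥ y ≠ 0 ∧ y ⬝ᵥ v = 0 ∧ u ⬝ᵥ ((reflection y).1 *ᵥ u) = e := by
  have he' : 1 - e ≠ 0 := sub_ne_zero.2 he.symm
  suffices ∃ y : ι → k, y ⬝ᵥ u ≠ 0 ∧ y ⬝ᵥ v = 0 ∧ (1 - e) * (y ⬝ᵥ y) = 2 * (y ⬝ᵥ u) ^ 2 by
    obtain ⟨y, hyu, hyv, hy⟩ := this
    have hyy : y ⬝ᵥ y ≠ 0 := by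
      intro h
      simp [h, h2, hyu] at hy
    refine ⟨y, hyy, hyv, ?_⟩
    simp only [reflection_mulVec, dotProduct_sub, dotProduct_smul, smul_eq_mul, hu,
      dotProduct_comm u y]
    field_simp
    linear_combination hy
  by_cases hc : (v ⬝ᵥ u) ^ 2 = 1
  · set c := v ⬝ᵥ u
    set w := u - c • v with hw
    have hwv : v ⬝ᵥ w = 0 := by simp [hw, hv, c]
    have hww : w ⬝ᵥ w = 0 := by
      simp only [hw, sub_dotProduct, dotProduct_sub, smul_dotProduct, dotProduct_smul, hu, hv,
        dotProduct_comm u v, smul_eq_mul]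
      linear_combination -hc
    have hw0 : w ≠ 0 := by
      intro h
      have huc : u = c • v := sub_eq_zero.1 h
      rcases sq_eq_one_iff.1 hc with h1 | h1 <;> simp_all
    have huw : u = c • v + w := by simp [hw]
    obtain ⟨m, hm⟩ := Function.ne_iff.1 hw0
    set z : ι → k := Pi.single m 1 - v m • v with hz
    have hzv : z ⬝ᵥ v = 0 := by simp [hz, hv]
    have hzw : z ⬝ᵥ w = w m := by simp [hz, hwv]
    have hm : w m ≠ 0 := hm
    refine ⟨z + ((2 * (w m) ^ 2 / (1 - e) - z ⬝ᵥ z) / (2 * w m)) • w, ?_, ?_, ?_⟩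
    · rw [huw]
      simpa [hzv, hzw, hww, dotProduct_comm w v, hwv] using hm
    · simp [hzv, dotProduct_comm w v, hwv]
    · rw [huw]
      simp only [add_dotProduct, dotProduct_add, smul_dotProduct, dotProduct_smul, hzv, hzw, hww,
        dotProduct_comm w v, hwv, dotProduct_comm w z, smul_eq_mul]
      field_simp
      ring
  · obtain ⟨d, w, hd0, hd, hww, hvw, huw⟩ := exists_unit_orthogonal_component hu hv hc
    obtain ⟨p, hpp, hvp, hwp⟩ := exists_unit_orthogonal_pair h2 hij hil hjl hv hww hvw
    obtain ⟨t, ht⟩ := IsAlgClosed.exists_pow_nat_eq (2 * d ^ 2 / (1 - e) - 1) two_pos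
    have hdu : (w + t • p) ⬝ᵥ u = d := by
      rw [huw]
      simp [hww, dotProduct_comm w v, hvw, dotProduct_comm p v, hvp, dotProduct_comm p w, hwp]
    refine ⟨w + t • p, by rwa [hdu], ?_, ?_⟩
    · simp [dotProduct_comm w v, hvw, dotProduct_comm p v, hvp]
    · rw [hdu]
      simp only [add_dotProduct, dotProduct_add, smul_dotProduct, dotProduct_smul, hww, hpp,
        hwp, dotProduct_comm p w, smul_eq_mul]
      field_simp at ht
      linear_combination ht

section Hom

variable {Q : Type*} [Group Q] (φ : orthogonalGroup ι k →* Q)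

theorem map_reflection_mulVec (g : orthogonalGroup ι k) (v : ι → k) :
    φ (reflection (g.1 *ᵥ v)) = φ g * φ (reflection v) * (φ g)⁻¹ := by
  rw [reflection_mulVec_eq_conj, map_mul, map_mul, map_inv]

variable [IsAlgClosed k]

theorem map_reflection_eq_of_dotProduct_ne (h2 : (2 : k) ≠ 0) {i j l : ι} (hij : i ≠ j)
    (hil : i ≠ l) (hjl : j ≠ l) {u v : ι → k} (hu : u ⬝ᵥ u = 1) (hv : v ⬝ᵥ v = 1)
    (huv : u ≠ v) (huv' : u ≠ -v)
    (hφ : φ (reflection u) = φ (reflection v)) {x y : ι → k} (hx : x ⬝ᵥ x = 1) (hy : y ⬝ᵥ y = 1)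
    (hxy : (x ⬝ᵥ y) ^ 2 ≠ 1) : φ (reflection x) = φ (reflection y) := by
  obtain ⟨z, -, hzv, hzu⟩ := exists_dotProduct_reflection_mulVec_eq h2 hij hil hjl hu hv huv huv'
    (e := x ⬝ᵥ y) (by intro h; simp [h] at hxy)
  set u' := (reflection z).1 *ᵥ u with hu'
  have hu'u' : u' ⬝ᵥ u' = 1 := by rw [hu', mulVec_dotProduct_mulVec, hu]
  have hφ' : φ (reflection u) = φ (reflection u') := by
    rw [hu', map_reflection_mulVec, hφ, ← map_reflection_mulVec,
      reflection_mulVec_of_dotProduct_eq_zero hzv]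
  obtain ⟨d, w, hd0, hd, hww, huw, hw⟩ :=
    exists_unit_orthogonal_component hu'u' hu (by rwa [hzu])
  obtain ⟨d', w', hd0', hd', hww', hxw', hw'⟩ := exists_unit_orthogonal_component hy hx hxy
  rw [hzu] at hd hw
  obtain ⟨g, hg, hg'⟩ := exists_mulVec_eq_and_mulVec_eq h2 hu hww huw hx
    (w' := (d' / d) • w') (by
      simp only [smul_dotProduct, dotProduct_smul, hww', smul_eq_mul]
      field_simp
      rw [hd, hd']) (by simp [hxw'])
  have hgy : g.1 *ᵥ u' = y := by
    rw [hw, mulVec_add, mulVec_smul, mulVec_smul, hg, hg', smul_smul, mul_div_cancel₀ _ hd0, ← hw']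
  rw [← hgy, ← hg, map_reflection_mulVec, map_reflection_mulVec, hφ']

theorem map_reflection_eq (h2 : (2 : k) ≠ 0) {i j l : ι} (hij : i ≠ j) (hil : i ≠ l)
    (hjl : j ≠ l) {u v : ι → k} (hu : u ⬝ᵥ u = 1) (hv : v ⬝ᵥ v = 1) (huv : u ≠ v) (huv' : u ≠ -v)
    (hφ : φ (reflection u) = φ (reflection v)) {x y : ι → k} (hx : x ⬝ᵥ x = 1)
    (hy : y ⬝ᵥ y = 1) : φ (reflection x) = φ (reflection y) := by
  by_cases hxy : (x ⬝ᵥ y) ^ 2 = 1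
  · suffices ∃ z : ι → k, z ⬝ᵥ z = 1 ∧ (x ⬝ᵥ z) ^ 2 ≠ 1 ∧ (z ⬝ᵥ y) ^ 2 ≠ 1 by
      obtain ⟨z, hz, hxz, hzy⟩ := this
      exact (map_reflection_eq_of_dotProduct_ne φ h2 hij hil hjl hu hv huv huv' hφ hx hz hxz).trans
        (map_reflection_eq_of_dotProduct_ne φ h2 hij hil hjl hu hv huv huv' hφ hz hy hzy)
    obtain ⟨p, hp, hxp⟩ := exists_unit_orthogonal h2 hij hx
    by_cases hpy : (p ⬝ᵥ y) ^ 2 = 1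
    · have := IsAlgClosed.instInfinite (K := k)
      classical
      obtain ⟨c, hc⟩ := Infinite.exists_notMem_finset ({0, 1, -1} : Finset k)
      simp only [Finset.mem_insert, Finset.mem_singleton, not_or] at hc
      obtain ⟨d, hd⟩ := IsAlgClosed.exists_pow_nat_eq (1 - c ^ 2) two_pos
      have hc1 : c ^ 2 ≠ 1 := by simp [hc]
      have hd0 : d ≠ 0 := by
        rintro rfl
        exact hc1 (by linear_combination hd)
      refine ⟨c • x + d • p, ?_, ?_, ?_⟩
      · simp [hx, hp, hxp, dotProduct_comm p x]
        linear_combination hd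
      · simpa [hx, hxp] using hc1
      · simp only [add_dotProduct, smul_dotProduct, smul_eq_mul]
        intro h
        have h0 : 2 * (c * d * ((x ⬝ᵥ y) * (p ⬝ᵥ y))) = 0 := by
          linear_combination h - c ^ 2 * hxy - d ^ 2 * hpy - hd
        have hx0 : x ⬝ᵥ y ≠ 0 := by intro h; simp [h] at hxy
        have hp0 : p ⬝ᵥ y ≠ 0 := by intro h; simp [h] at hpy
        simp [h2, hc.1, hd0, hx0, hp0] at h0
    · exact ⟨p, hp, by simp [hxp], hpy⟩
  · exact map_reflection_eq_of_dotProduct_ne φ h2 hij hil hjl hu hv huv huv' hφ hx hy hxy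

/-- If a homomorphism is constant on reflections, then it is trivial on the special orthogonal
group. -/
theorem map_eq_one_of_det_eq_one (h2 : (2 : k) ≠ 0) {r : Q}
    (hr : ∀ v : ι → k, v ⬝ᵥ v = 1 → φ (reflection v) = r) {A : orthogonalGroup ι k}
    (hA : A.1.det = 1) : φ A = 1 := by
  have hneg : (-1 : k) ≠ 1 := fun h => h2 (by linear_combination -h)
  suffices (A.1.det = 1 ∧ φ A = 1) ∨ (A.1.det = -1 ∧ φ A = r ∧ r * r = 1) by
    rcases this with h | h
    · exact h.2
    · exact absurd (h.1.symm.trans hA) hneg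
  have hmem := mem_reflectionSubgroup h2 A
  clear hA
  unfold reflectionSubgroup at hmem
  induction hmem using Subgroup.closure_induction with
  | mem x hx =>
    obtain ⟨v, hv, rfl⟩ := hx
    obtain ⟨c, u, hc, hu, rfl⟩ := exists_unit_smul_eq hv
    refine Or.inr ⟨det_reflection hv, ?_, ?_⟩
    · rw [reflection_smul hc, hr u hu]
    · rw [← hr u hu, ← map_mul, reflection_mul_self, map_one]
  | one => simp
  | mul x y _ _ hx hy =>
    have hdet : (x * y).1.det = x.1.det * y.1.det := det_mul _ _
    rw [hdet, map_mul]
    rcases hx with ⟨hx, hx'⟩ | ⟨hx, hx', hr'⟩ <;> rcases hy with ⟨hy, hy'⟩ | ⟨hy, hy', hr''⟩ <;>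
      simp_all
  | inv x _ hx =>
    have hdet : (x⁻¹).1.det = x.1.det := det_transpose _
    rw [hdet, map_inv]
    rcases hx with ⟨hx, hx'⟩ | ⟨hx, hx', hr'⟩
    · simp [hx, hx']
    · exact Or.inr ⟨hx, by rw [hx', inv_eq_of_mul_eq_one_left hr'], hr'⟩

/-- An orthogonal matrix mapping every unit vector `v` to `v` or `-v` is `1` or `-1`. -/
theorem eq_one_or_eq_neg_one (h2 : (2 : k) ≠ 0) {A : orthogonalGroup ι k}
    (hA : ∀ v : ι → k, v ⬝ᵥ v = 1 → A.1 *ᵥ v = v ∨ A.1 *ᵥ v = -v) : A.1 = 1 ∨ A.1 = -1 := by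
  have hA' : ∀ v : ι → k, v ⬝ᵥ v ≠ 0 → A.1 *ᵥ v = v ∨ A.1 *ᵥ v = -v := by
    intro v hv
    obtain ⟨c, u, -, hu, rfl⟩ := exists_unit_smul_eq hv
    rcases hA u hu with h | h <;> simp [mulVec_smul, h]
  have hone : (1 : k) ≠ -1 := fun h => h2 (by linear_combination h)
  have hsum : ∀ i j : ι, A.1 *ᵥ Pi.single i 1 = Pi.single i 1 →
      A.1 *ᵥ Pi.single j 1 = -Pi.single j 1 → False := by
    intro i j hi hj
    have hij : i ≠ j := by
      rintro rfl
      have := congrFun (hi.symm.trans hj) i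
      simp [hone] at this
    rcases hA' (Pi.single i 1 + Pi.single j 1)
      (by simpa [hij, hij.symm, one_add_one_eq_two] using h2) with h | h
    · have := congrFun h j
      simp [mulVec_add, hi, hj, hij.symm, hone.symm, -mulVec_single] at this
    · have := congrFun h i
      simp [mulVec_add, hi, hj, hij, hone, -mulVec_single] at this
  by_cases h : ∃ i : ι, A.1 *ᵥ Pi.single i 1 = Pi.single i 1
  · obtain ⟨i, hi⟩ := h
    refine Or.inl (Matrix.ext_of_mulVec_single fun j => ?_)
    rw [one_mulVec]
    exact (hA _ (by simp)).resolve_right (hsum i j hi)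
  · refine Or.inr (Matrix.ext_of_mulVec_single fun j => ?_)
    rw [neg_mulVec, one_mulVec]
    exact (hA _ (by simp)).resolve_left fun hj => h ⟨j, hj⟩

/-- A homomorphism killing a nonscalar orthogonal matrix kills the special orthogonal group. -/
theorem map_eq_one (h2 : (2 : k) ≠ 0) {i j l : ι} (hij : i ≠ j) (hil : i ≠ l)
    (hjl : j ≠ l) {A : orthogonalGroup ι k} (hφ : φ A = 1) (hA : ¬(A.1 = 1 ∨ A.1 = -1))
    {B : orthogonalGroup ι k} (hB : B.1.det = 1) : φ B = 1 := by
  obtain ⟨v, hv, hne⟩ : ∃ v : ι → k, v ⬝ᵥ v = 1 ∧ ¬(A.1 *ᵥ v = v ∨ A.1 *ᵥ v = -v) := by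
    by_contra! h
    exact hA (eq_one_or_eq_neg_one h2 h)
  rw [not_or] at hne
  refine map_eq_one_of_det_eq_one φ h2 (r := φ (reflection v)) (fun x hx => ?_) hB
  refine map_reflection_eq φ h2 hij hil hjl (u := A.1 *ᵥ v)
    (by rw [mulVec_dotProduct_mulVec, hv]) hv hne.1 hne.2 ?_ hx hv
  rw [map_reflection_mulVec, hφ, one_mul, inv_one, mul_one]

end Hom

end Matrix.orthogonalGroup

/-- Over an algebraically closed field of characteristic `≠ 2` and for `n ≥ 3`, a
normal subgroup of the orthogonal group `O_n(k)` which does not contain `SO_n(k)`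
is contained in the center `{1, -1}`. -/
theorem stmt_4 (k : Type*) [Field k] [IsAlgClosed k] (h2 : (2 : k) ≠ 0)
    (n : ℕ) (hn : 3 ≤ n)
    (H : Subgroup (Matrix.orthogonalGroup (Fin n) k)) (hH : H.Normal)
    (hSO : ¬ ∀ A : Matrix.orthogonalGroup (Fin n) k,
        (A : Matrix (Fin n) (Fin n) k).det = 1 → A ∈ H) :
    ∀ A ∈ H, (A : Matrix (Fin n) (Fin n) k) = 1 ∨
      (A : Matrix (Fin n) (Fin n) k) = -1 := by
  by_contra! h
  obtain ⟨A, hA, hne⟩ := h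
  refine hSO fun B hB => ?_
  rw [← QuotientGroup.eq_one_iff]
  exact Matrix.orthogonalGroup.map_eq_one (QuotientGroup.mk' H) h2
    (i := ⟨0, by omega⟩) (j := ⟨1, by omega⟩) (l := ⟨2, by omega⟩) (by simp) (by simp) (by simp)
    ((QuotientGroup.eq_one_iff A).2 hA) (not_or.2 hne) hB
end

section
/- Let m ≥ 1 and C ≥ 0 be integers. There exists a constant c, depending only on m and C, with the following property: for every finite set V and every symmetric relation r on V (loops allowed, i.e. r(v,v) is permitted) such that every vertex has at most C neighbours (for every v ∈ V, the set { w ∈ V : r(v,w) } has at most C elements), the set Δ_m = { (v_1,…,v_{2m}) ∈ V^{2m} : for each i ∈ {1,…,2m} there exists j ≠ i with r(v_i, v_j) } has cardinality at most c · |V|^m. -/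
/-- A symmetric relation on a finite type in which every element is related to some other element
has a dominating set containing at most half of the elements. -/
theorem exists_dominating_two_mul_card_le {ι : Type*} [Fintype ι] [DecidableEq ι]
    (a : ι → ι → Prop) (symm : ∀ i j, a i j → a j i) (h : ∀ i, ∃ j, j ≠ i ∧ a i j) :
    ∃ S : Finset ι, 2 * S.card ≤ Fintype.card ι ∧ ∀ i, i ∈ S ∨ ∃ j ∈ S, a i j := by
  obtain ⟨S, hS, hmin⟩ := Finset.exists_min_image
    (Set.toFinite {S : Finset ι | ∀ i, i ∈ S ∨ ∃ j ∈ S, a i j}).toFinset Finset.card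
    ⟨Finset.univ, by simp⟩
  simp only [Set.Finite.mem_toFinset, Set.mem_ofPred_eq] at hS hmin
  have hcompl : ∀ i, i ∈ Sᶜ ∨ ∃ j ∈ Sᶜ, a i j := by
    intro i
    by_cases hi : i ∈ S
    · right
      have hnot : ¬ ∀ k, k ∈ S.erase i ∨ ∃ j ∈ S.erase i, a k j := fun hk =>
        absurd (hmin _ hk) (Finset.card_erase_lt_of_mem hi).not_ge
      push Not at hnot
      obtain ⟨k, hk, hkn⟩ := hnot
      simp only [Finset.mem_erase, not_and] at hk hkn
      by_cases hki : k = i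
      · subst hki
        obtain ⟨j, hj, hij⟩ := h k
        exact ⟨j, Finset.mem_compl.2 fun hjS => hkn j ⟨hj, hjS⟩ hij, hij⟩
      · obtain hkS | ⟨j, hjS, hkj⟩ := hS k
        · exact absurd hkS (hk hki)
        · have hji : j = i := by
            by_contra hji
            exact hkn j ⟨hji, hjS⟩ hkj
          subst hji
          exact ⟨k, Finset.mem_compl.2 (hk hki), symm _ _ hkj⟩
    · exact Or.inl (Finset.mem_compl.2 hi)
  have hcard := Finset.card_add_card_compl S
  exact ⟨S, by have := hmin _ hcompl; lia, hS⟩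

/-- Each closed neighbourhood of a relation of degree at most `C` can be labelled injectively
by `C + 1` labels. -/
theorem exists_injOn_closed_neighborhood {V : Type*} [Finite V] (r : V → V → Prop) (C : ℕ) (v : V)
    (hC : Nat.card {w : V // r v w} ≤ C) :
    ∃ label : V → Fin (C + 1), Set.InjOn label {w | w = v ∨ r v w} := by
  have hle : Set.ncard {w | w = v ∨ r v w} ≤ C + 1 :=
    (Set.ncard_insert_le v {w | r v w}).trans (Nat.succ_le_succ hC)
  classical
  obtain ⟨f⟩ : Nonempty ({w | w = v ∨ r v w} ↪ Fin (C + 1)) := by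
    have := Fintype.ofFinite {w | w = v ∨ r v w}
    refine Function.Embedding.nonempty_of_card_le ?_
    rwa [← Nat.card_eq_fintype_card, Fintype.card_fin]
  refine ⟨fun w => if hw : w ∈ {w | w = v ∨ r v w} then f ⟨w, hw⟩ else 0, ?_⟩
  intro x hx y hy hxy
  simp only [dif_pos hx, dif_pos hy] at hxy
  exact congrArg Subtype.val (f.injective hxy)

/-- A tuple of length `2 * m` in which every entry is related to another one has `m` entries
such that every entry equals, or is related to, one of them. -/
theorem exists_dominating_entries {V : Type*} (r : V → V → Prop) (symm : ∀ v w, r v w → r w v)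
    {m : ℕ} (t : Fin (2 * m) → V) (ht : ∀ i, ∃ j, j ≠ i ∧ r (t i) (t j)) :
    ∃ (e : Fin m → Fin (2 * m)) (p : Fin (2 * m) → Fin m),
      ∀ i, t i = t (e (p i)) ∨ r (t (e (p i))) (t i) := by
  obtain ⟨S, hcard, hS⟩ := exists_dominating_two_mul_card_le (fun i j => r (t i) (t j))
    (fun _ _ => symm _ _) ht
  rw [Fintype.card_fin] at hcard
  obtain ⟨T, hST, hT⟩ := Finset.exists_superset_card_eq (s := S) (n := m) (by lia)
    (by rw [Fintype.card_fin]; lia)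
  have hsurj : ∀ j ∈ S, ∃ k, (T.orderEmbOfFin hT) k = j := fun j hj => by
    have : j ∈ Set.range (T.orderEmbOfFin hT) := by
      rw [Finset.range_orderEmbOfFin]
      exact hST hj
    exact this
  have hp : ∀ i, ∃ k, t i = t (T.orderEmbOfFin hT k) ∨ r (t (T.orderEmbOfFin hT k)) (t i) := by
    intro i
    obtain hi | ⟨j, hj, hij⟩ := hS i
    · obtain ⟨k, hk⟩ := hsurj i hi
      exact ⟨k, Or.inl (by rw [hk])⟩
    · obtain ⟨k, hk⟩ := hsurj j hj
      exact ⟨k, Or.inr (by rw [hk]; exact symm _ _ hij)⟩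
  choose p hp using hp
  exact ⟨T.orderEmbOfFin hT, p, hp⟩

/-- Combinatorial graph lemma: for a finite graph with maximal degree at most `C`,
the number of `2m`-tuples of vertices in which every coordinate is adjacent to some
other coordinate is `O(|V|^m)`, with implied constant depending only on `m` and `C`. -/
theorem stmt_7 (m C : ℕ) (hm : 1 ≤ m) :
    ∃ c : ℝ, 0 < c ∧ ∀ (V : Type) [Fintype V] (r : V → V → Prop),
      (∀ v w : V, r v w → r w v) →
      (∀ v : V, Nat.card {w : V // r v w} ≤ C) →
      (Nat.card {t : Fin (2 * m) → V // ∀ i, ∃ j, j ≠ i ∧ r (t i) (t j)} : ℝ) ≤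
        c * (Nat.card V : ℝ) ^ m := by
  refine ⟨((2 * m) ^ m * m ^ (2 * m) * (C + 1) ^ (2 * m) : ℕ), by positivity, ?_⟩
  intro V _ r symm hC
  choose label hlabel using fun v => exists_injOn_closed_neighborhood r C v (hC v)
  choose e p hep using fun t : {t : Fin (2 * m) → V // ∀ i, ∃ j, j ≠ i ∧ r (t i) (t j)} =>
    exists_dominating_entries r symm t.1 t.2
  let code (t : {t : Fin (2 * m) → V // ∀ i, ∃ j, j ≠ i ∧ r (t i) (t j)}) :
      (((Fin m → Fin (2 * m)) × (Fin (2 * m) → Fin m)) × (Fin (2 * m) → Fin (C + 1))) ×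
        (Fin m → V) :=
    (((e t, p t), fun i => label (t.1 (e t (p t i))) (t.1 i)), fun k => t.1 (e t k))
  have hcode : Function.Injective code := by
    intro t u htu
    simp only [code, Prod.mk.injEq] at htu
    obtain ⟨⟨⟨he, hp⟩, hl⟩, hs⟩ := htu
    ext i
    have hroot : t.1 (e t (p t i)) = u.1 (e u (p u i)) := by
      rw [← hp]
      exact congrFun hs (p t i)
    have hl_i := congrFun hl i
    have ht := hep t i
    have hu := hep u i
    simp only [hroot] at hl_i ht
    exact hlabel _ ht hu hl_i
  have hle := Nat.card_le_card_of_injective code hcode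
  simp only [Nat.card_prod, Nat.card_fun, Nat.card_fin] at hle
  exact_mod_cast hle
end
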